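/- arXiv:math/0209117 — 10 statements merged into one kernel-verified Lean document; each statement's English description precedes it below -/
import Mathlib

section
/- Let n, N, d be positive integers and let W be the complex vector space of symmetric tensors a : (Fin n)^N → ℂ (equivalently, of complex homogeneous forms of degree N in n variables), on which GL(n,ℂ) acts by substitution: (m·a) is the tensor of the polynomial p(mX), i.e. (m·a)_{i…j} = Σ a_{p…q} m^p_i ⋯ m^q_j. Suppose P : W → ℂ is a polynomial function, homogeneous of degree d, satisfying P(m·a) = P(a) for all m ∈ SL(n,ℂ) and all a ∈ W, and P is not identically zero. Then n divides dN, and P(m·a) = (det m)^{dN/n} · P(a) for all m ∈ GL(n,ℂ) and all a ∈ W. -/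
noncomputable section
open Finset MvPolynomial

/-- A tensor `a : (Fin n)^N → ℂ` is symmetric if it is invariant under
permutations of its `N` indices. -/
def IsSymTensor {n N : ℕ} (a : (Fin N → Fin n) → ℂ) : Prop :=
  ∀ σ : Equiv.Perm (Fin N), ∀ i : Fin N → Fin n, a (i ∘ σ) = a i

/-- The substitution action of a matrix `m` on tensors:
`(m·a)_{i…j} = Σ a_{p…q} m^p_i ⋯ m^q_j`. -/
def tensorAct {n N : ℕ} (m : Matrix (Fin n) (Fin n) ℂ) (a : (Fin N → Fin n) → ℂ) :
    (Fin N → Fin n) → ℂ :=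
  fun i => ∑ p : Fin N → Fin n, a p * ∏ k : Fin N, m (p k) (i k)

lemma IsSymTensor.tensorAct {n N : ℕ} {a : (Fin N → Fin n) → ℂ} (ha : IsSymTensor a)
    (m : Matrix (Fin n) (Fin n) ℂ) : IsSymTensor (tensorAct m a) := by
  intro σ i
  refine (Fintype.sum_equiv (σ.arrowCongr (Equiv.refl (Fin n))) _ _ fun p => ?_)
  have hp : σ.arrowCongr (Equiv.refl (Fin n)) p = p ∘ σ.symm := rfl
  rw [hp, ha σ.symm p]
  congr 1
  exact Fintype.prod_equiv σ _ _ fun k => by simp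

lemma tensorAct_smul {n N : ℕ} (c : ℂ) (m : Matrix (Fin n) (Fin n) ℂ)
    (a : (Fin N → Fin n) → ℂ) : tensorAct (c • m) a = c ^ N • tensorAct m a := by
  funext i
  simp only [tensorAct, Matrix.smul_apply, smul_eq_mul, Pi.smul_apply, Finset.prod_mul_distrib,
    Finset.prod_const, Finset.card_univ, Fintype.card_fin, Finset.mul_sum]
  exact Finset.sum_congr rfl fun p _ => by ring

/-- If `c ^ n = det m ≠ 0`, an `SL(n,ℂ)`-invariant function, homogeneous of degree `d`, is
multiplied by `c ^ (d * N)` under the action of `m`. -/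
lemma apply_tensorAct_of_pow_eq_det {n N d : ℕ} {P : ((Fin N → Fin n) → ℂ) → ℂ}
    (hhom : ∀ (c : ℂ) (a : (Fin N → Fin n) → ℂ), IsSymTensor a → P (c • a) = c ^ d * P a)
    (hSL : ∀ m : Matrix (Fin n) (Fin n) ℂ, m.det = 1 →
      ∀ a, IsSymTensor a → P (tensorAct m a) = P a)
    {c : ℂ} (hc : c ≠ 0) {m : Matrix (Fin n) (Fin n) ℂ} (hm : c ^ n = m.det)
    {a : (Fin N → Fin n) → ℂ} (ha : IsSymTensor a) :
    P (tensorAct m a) = c ^ (d * N) * P a := by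
  have hdet : (c⁻¹ • m).det = 1 := by
    rw [Matrix.det_smul, Fintype.card_fin, ← hm, inv_pow, inv_mul_cancel₀ (pow_ne_zero n hc)]
  have hscale : m = c • c⁻¹ • m := by rw [smul_smul, mul_inv_cancel₀ hc, one_smul]
  conv_lhs => rw [hscale]
  rw [tensorAct_smul, hhom _ _ (ha.tensorAct _), hSL _ hdet a ha, ← pow_mul, mul_comm N d]

/-- If `P` is a polynomial function on the space of symmetric tensors
(homogeneous degree-`N` forms in `n` variables), homogeneous of degree `d`,
invariant under `SL(n,ℂ)` and not identically zero, then `n ∣ d * N` and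
`P(m·a) = (det m)^{dN/n} · P(a)` for every `m ∈ GL(n,ℂ)`. -/
theorem statement0 (n N d : ℕ) (hn : 0 < n) (hN : 0 < N) (hd : 0 < d)
    (P : ((Fin N → Fin n) → ℂ) → ℂ)
    (hpoly : ∃ p : MvPolynomial (Fin N → Fin n) ℂ,
      ∀ a, IsSymTensor a → P a = MvPolynomial.eval a p)
    (hhom : ∀ (c : ℂ) (a : (Fin N → Fin n) → ℂ), IsSymTensor a → P (c • a) = c ^ d * P a)
    (hSL : ∀ m : Matrix (Fin n) (Fin n) ℂ, m.det = 1 →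
      ∀ a, IsSymTensor a → P (tensorAct m a) = P a)
    (hne : ∃ a, IsSymTensor a ∧ P a ≠ 0) :
    n ∣ d * N ∧
      ∀ m : Matrix (Fin n) (Fin n) ℂ, IsUnit m.det →
        ∀ a, IsSymTensor a → P (tensorAct m a) = m.det ^ (d * N / n) * P a := by
  have hdvd : n ∣ d * N := by
    obtain ⟨a, ha, hPa⟩ := hne
    have hζ := Complex.isPrimitiveRoot_exp n hn.ne'
    have hdet : Complex.exp (2 * Real.pi * Complex.I / n) ^ n =
        (1 : Matrix (Fin n) (Fin n) ℂ).det := by rw [hζ.pow_eq_one, Matrix.det_one]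
    have h := apply_tensorAct_of_pow_eq_det hhom hSL (hζ.ne_zero hn.ne') hdet ha
    rw [hSL 1 Matrix.det_one a ha] at h
    exact hζ.dvd_of_pow_eq_one _ (mul_right_cancel₀ hPa (h.symm.trans (one_mul _).symm))
  refine ⟨hdvd, fun m hm a ha => ?_⟩
  obtain ⟨c, hc⟩ := IsAlgClosed.exists_pow_nat_eq m.det hn
  have hc0 : c ≠ 0 := by
    rintro rfl
    exact hm.ne_zero (by rw [← hc, zero_pow hn.ne'])
  rw [apply_tensorAct_of_pow_eq_det hhom hSL hc0 hc ha, ← hc, ← pow_mul, Nat.mul_div_cancel' hdvd]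
end
end

section
/- For every symmetric tensor a : (Fin 3)³ → ℂ and every m ∈ GL(3,ℂ), the ternary cubic invariants satisfy J(m·a) = (det m)⁴ · J(a) and K(m·a) = (det m)⁶ · K(a), where (m·a)_{ijk} = Σ_{p,q,r} a_{pqr} m^p_i m^q_j m^r_k. -/
noncomputable section
open Finset

/-- The totally antisymmetric symbol on three indices with `ε^{123} = 1`
(indices `0,1,2` in `Fin 3`). -/
def eps3 : Fin 3 → Fin 3 → Fin 3 → ℂ := fun i j k =>
  if (i, j, k) = (0, 1, 2) ∨ (i, j, k) = (1, 2, 0) ∨ (i, j, k) = (2, 0, 1) then 1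
  else if (i, j, k) = (0, 2, 1) ∨ (i, j, k) = (2, 1, 0) ∨ (i, j, k) = (1, 0, 2) then -1
  else 0

/-- The partial contraction `b_{ij}^{kl} = Σ a_{pqi} a_{rsj} ε^{prk} ε^{qsl}`. -/
def bT (a : Fin 3 → Fin 3 → Fin 3 → ℂ) (i j k l : Fin 3) : ℂ :=
  ∑ p : Fin 3, ∑ q : Fin 3, ∑ r : Fin 3, ∑ s : Fin 3,
    a p q i * a r s j * eps3 p r k * eps3 q s l

/-- The partial contraction `c_{ijk} = Σ b_{ij}^{pq} a_{pqk}`. -/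
def cT (a : Fin 3 → Fin 3 → Fin 3 → ℂ) (i j k : Fin 3) : ℂ :=
  ∑ p : Fin 3, ∑ q : Fin 3, bT a i j p q * a p q k

/-- The partial contraction `d^{ijk} = Σ b_{pq}^{ir} a_{rst} ε^{ptk} ε^{qjs}`. -/
def dT (a : Fin 3 → Fin 3 → Fin 3 → ℂ) (i j k : Fin 3) : ℂ :=
  ∑ p : Fin 3, ∑ q : Fin 3, ∑ r : Fin 3, ∑ s : Fin 3, ∑ t : Fin 3,
    bT a p q i r * a r s t * eps3 p t k * eps3 q j s

/-- The degree-4 invariant `J = Σ b_{ij}^{kl} b_{kl}^{ij}` of a ternary cubic. -/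
def JT (a : Fin 3 → Fin 3 → Fin 3 → ℂ) : ℂ :=
  ∑ i : Fin 3, ∑ j : Fin 3, ∑ k : Fin 3, ∑ l : Fin 3, bT a i j k l * bT a k l i j

/-- The degree-6 invariant `K = Σ c_{ijk} d^{ijk}` of a ternary cubic. -/
def KT (a : Fin 3 → Fin 3 → Fin 3 → ℂ) : ℂ :=
  ∑ i : Fin 3, ∑ j : Fin 3, ∑ k : Fin 3, cT a i j k * dT a i j k

/-- A ternary tensor is symmetric if invariant under permutations of its indices. -/
def SymT (a : Fin 3 → Fin 3 → Fin 3 → ℂ) : Prop :=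
  ∀ i j k : Fin 3, a i j k = a j i k ∧ a i j k = a i k j

/-- The substitution action `(m·a)_{ijk} = Σ_{p,q,r} a_{pqr} m^p_i m^q_j m^r_k`. -/
def actT (m : Matrix (Fin 3) (Fin 3) ℂ) (a : Fin 3 → Fin 3 → Fin 3 → ℂ) :
    Fin 3 → Fin 3 → Fin 3 → ℂ := fun i j k =>
  ∑ p : Fin 3, ∑ q : Fin 3, ∑ r : Fin 3, a p q r * m p i * m q j * m r k

/-- The complete contraction of copies of `a` (labelled by `V`) with copies of `ε` (labelled by
`E`). The indices are labelled by `ι`; `α` and `β` say in which slot of which copy of `a`,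
respectively `ε`, an index occurs. -/
def contraction {V E ι : Type*} [Fintype V] [Fintype E] [Fintype ι] [DecidableEq ι]
    (α : V × Fin 3 → ι) (β : E × Fin 3 → ι) (a : Fin 3 → Fin 3 → Fin 3 → ℂ) : ℂ :=
  ∑ f : ι → Fin 3, (∏ v, a (f (α (v, 0))) (f (α (v, 1))) (f (α (v, 2)))) *
    ∏ e, eps3 (f (β (e, 0))) (f (β (e, 1))) (f (β (e, 2)))

theorem sum_fin_succ_arrow {X M : Type*} [Fintype X] [AddCommMonoid M] {n : ℕ}
    (F : (Fin (n + 1) → X) → M) :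
    ∑ f, F f = ∑ x, ∑ g : Fin n → X, F (Matrix.vecCons x g) := by
  rw [← (Fin.consEquiv fun _ => X).sum_comp, Fintype.sum_prod_type]
  rfl

theorem sum_fin_zero_arrow {X M : Type*} [Fintype X] [AddCommMonoid M]
    (F : (Fin 0 → X) → M) : ∑ f, F f = F ![] := by
  rw [Fintype.sum_unique]
  exact congrArg F (Subsingleton.elim _ _)

theorem actT_eq_sum (m : Matrix (Fin 3) (Fin 3) ℂ) (a : Fin 3 → Fin 3 → Fin 3 → ℂ)
    (x : Fin 3 → Fin 3) :
    actT m a (x 0) (x 1) (x 2) =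
      ∑ g : Fin 3 → Fin 3, a (g 0) (g 1) (g 2) * ∏ t, m (g t) (x t) := by
  simp only [actT, sum_fin_succ_arrow, sum_fin_zero_arrow, Fin.prod_univ_three, Matrix.cons_val,
    mul_assoc]

/-- The symbol `ε` is a relative invariant of weight one. -/
theorem sum_prod_mul_eps3 (m : Matrix (Fin 3) (Fin 3) ℂ) (x : Fin 3 → Fin 3) :
    ∑ h : Fin 3 → Fin 3, (∏ t, m (x t) (h t)) * eps3 (h 0) (h 1) (h 2) =
      m.det * eps3 (x 0) (x 1) (x 2) := by
  simp only [sum_fin_succ_arrow, sum_fin_zero_arrow, Fin.prod_univ_three, Matrix.cons_val,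
    Matrix.det_fin_three]
  generalize x 0 = i, x 1 = j, x 2 = k
  fin_cases i <;> fin_cases j <;> fin_cases k <;>
    simp [Fin.sum_univ_three, eps3] <;> ring

theorem prod_sum_slots {V ι : Type*} [Fintype V] [Fintype ι] [DecidableEq V] [DecidableEq ι]
    (α : V × Fin 3 ≃ ι) (F : V → (Fin 3 → Fin 3) → ℂ) :
    ∏ v, ∑ g, F v g = ∑ f : ι → Fin 3, ∏ v, F v fun t => f (α (v, t)) := by
  rw [Fintype.prod_sum]
  exact (((α.arrowCongr (Equiv.refl (Fin 3))).symm.trans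
    (Equiv.curry V (Fin 3) (Fin 3))).sum_comp fun g => ∏ v, F v (g v)).symm

theorem contraction_actT {V E ι : Type*} [Fintype V] [Fintype E] [Fintype ι] [DecidableEq V]
    [DecidableEq E] [DecidableEq ι] (α : V × Fin 3 ≃ ι) (β : E × Fin 3 ≃ ι)
    (m : Matrix (Fin 3) (Fin 3) ℂ) (a : Fin 3 → Fin 3 → Fin 3 → ℂ) :
    contraction α β (actT m a) = m.det ^ Fintype.card E * contraction α β a := by
  have act (f : ι → Fin 3) :
      ∏ v, actT m a (f (α (v, 0))) (f (α (v, 1))) (f (α (v, 2))) =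
        ∑ g : ι → Fin 3, (∏ v, a (g (α (v, 0))) (g (α (v, 1))) (g (α (v, 2)))) *
          ∏ x, m (g x) (f x) := by
    simp_rw [fun v => actT_eq_sum m a fun t => f (α (v, t))]
    rw [prod_sum_slots α]
    refine sum_congr rfl fun g _ => ?_
    rw [prod_mul_distrib, ← α.prod_comp fun x => m (g x) (f x), Fintype.prod_prod_type]
  have eps (g : ι → Fin 3) :
      ∑ f : ι → Fin 3, (∏ x, m (g x) (f x)) *
          ∏ e, eps3 (f (β (e, 0))) (f (β (e, 1))) (f (β (e, 2))) =
        m.det ^ Fintype.card E *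
          ∏ e, eps3 (g (β (e, 0))) (g (β (e, 1))) (g (β (e, 2))) := by
    rw [← card_univ, ← prod_const, ← prod_mul_distrib]
    simp_rw [← fun e => sum_prod_mul_eps3 m fun t => g (β (e, t))]
    rw [prod_sum_slots β]
    refine sum_congr rfl fun f _ => ?_
    rw [prod_mul_distrib, ← β.prod_comp fun x => m (g x) (f x), Fintype.prod_prod_type]
  simp only [contraction, act, sum_mul]
  rw [sum_comm, mul_sum]
  refine sum_congr rfl fun g _ => ?_
  simp only [mul_assoc]
  rw [← mul_sum, eps]
  ring

/-- The labelling of `n * 3` slots given by a table. -/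
def slots {n N : ℕ} (T : Fin n → Fin 3 → Fin N) : Fin n × Fin 3 → Fin N := fun x => T x.1 x.2

def tensorSlotsJ : Fin 4 → Fin 3 → Fin 12 := ![![4, 5, 0], ![6, 7, 1], ![8, 9, 2], ![10, 11, 3]]

def epsSlotsJ : Fin 4 → Fin 3 → Fin 12 := ![![4, 6, 2], ![5, 7, 3], ![8, 10, 0], ![9, 11, 1]]

def tensorSlotsK : Fin 6 → Fin 3 → Fin 18 :=
  ![![5, 6, 0], ![7, 8, 1], ![3, 4, 2], ![14, 15, 9], ![16, 17, 10], ![11, 12, 13]]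

def epsSlotsK : Fin 6 → Fin 3 → Fin 18 :=
  ![![5, 7, 3], ![6, 8, 4], ![14, 16, 0], ![15, 17, 11], ![9, 13, 2], ![10, 1, 12]]

theorem contraction_slots_actT {n N : ℕ} {S T : Fin n → Fin 3 → Fin N}
    (hS : Function.Injective (slots S)) (hT : Function.Injective (slots T)) (hN : n * 3 = N)
    (m : Matrix (Fin 3) (Fin 3) ℂ) (a : Fin 3 → Fin 3 → Fin 3 → ℂ) :
    contraction (slots S) (slots T) (actT m a) =
      m.det ^ n * contraction (slots S) (slots T) a := by
  have card : Fintype.card (Fin n × Fin 3) = Fintype.card (Fin N) := by simp [hN]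
  have h := contraction_actT
    (Equiv.ofBijective _ ((Fintype.bijective_iff_injective_and_card _).2 ⟨hS, card⟩))
    (Equiv.ofBijective _ ((Fintype.bijective_iff_injective_and_card _).2 ⟨hT, card⟩)) m a
  simpa using h

theorem JT_eq_contraction (a : Fin 3 → Fin 3 → Fin 3 → ℂ) :
    JT a = contraction (slots tensorSlotsJ) (slots epsSlotsJ) a := by
  simp only [JT, bT, sum_mul]
  simp only [mul_sum]
  rw [contraction]
  repeat
    rw [sum_fin_succ_arrow]
    refine sum_congr rfl fun _ _ => ?_
  rw [sum_fin_zero_arrow]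
  simp only [slots, tensorSlotsJ, epsSlotsJ, Fin.prod_univ_four, Matrix.cons_val]
  ring

theorem KT_eq_contraction (a : Fin 3 → Fin 3 → Fin 3 → ℂ) :
    KT a = contraction (slots tensorSlotsK) (slots epsSlotsK) a := by
  rw [KT, contraction]
  -- Expanding all the sums at once is too expensive, so they are matched from the outside in.
  repeat
    first
    | rw [sum_fin_succ_arrow]
      refine sum_congr rfl fun _ _ => ?_
    | simp only [cT, bT, sum_mul]
    | simp only [dT, bT, sum_mul, mul_sum]
  rw [sum_fin_zero_arrow]
  simp only [slots, tensorSlotsK, epsSlotsK, Fin.prod_univ_six, Matrix.cons_val]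
  ring

/-- For every symmetric ternary cubic tensor `a` and every `m ∈ GL(3,ℂ)`,
`J(m·a) = (det m)⁴ J(a)` and `K(m·a) = (det m)⁶ K(a)`. -/
theorem statement2 (a : Fin 3 → Fin 3 → Fin 3 → ℂ) (ha : SymT a)
    (m : Matrix (Fin 3) (Fin 3) ℂ) (hm : IsUnit m.det) :
    JT (actT m a) = m.det ^ 4 * JT a ∧ KT (actT m a) = m.det ^ 6 * KT a := by
  simp only [JT_eq_contraction, KT_eq_contraction]
  exact ⟨contraction_slots_actT (by decide) (by decide) rfl m a,
    contraction_slots_actT (by decide) (by decide) rfl m a⟩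
end
end

section
/- For every symmetric tensor a : (Fin 3)³ → ℂ and every m ∈ GL(3,ℂ), the ratio J³/(J³ − 6K²) for a ternary cubic is independent of coordinates: J(m·a)³ · (J(a)³ − 6K(a)²) = J(a)³ · (J(m·a)³ − 6K(m·a)²), where (m·a)_{ijk} = Σ_{p,q,r} a_{pqr} m^p_i m^q_j m^r_k. -/
noncomputable section
open Finset

open Matrix Kronecker

/-- The cyclic contraction `Σ X_{pq} Y_{pr} Z_{rs} W_{qs}` of four matrices. -/
def cyc (X Y Z W : Matrix (Fin 3) (Fin 3) ℂ) : ℂ := trace (Xᵀ * Y * Z * Wᵀ)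

lemma cyc_eq_sum (X Y Z W : Matrix (Fin 3) (Fin 3) ℂ) :
    cyc X Y Z W = ∑ p, ∑ q, ∑ r, ∑ s, X p q * Z r s * Y p r * W q s := by
  simp only [cyc, trace, diag_apply, mul_apply, transpose_apply, sum_mul]
  simp only [Fin.sum_univ_three]
  ring

lemma cyc_sum₁ {ι : Type*} (s : Finset ι) (c : ι → ℂ) (X : ι → Matrix (Fin 3) (Fin 3) ℂ)
    (Y Z W : Matrix (Fin 3) (Fin 3) ℂ) :
    cyc (∑ i ∈ s, c i • X i) Y Z W = ∑ i ∈ s, c i * cyc (X i) Y Z W := by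
  simp [cyc, transpose_sum, Matrix.sum_mul, trace_sum]

lemma cyc_sum₂ {ι : Type*} (s : Finset ι) (c : ι → ℂ) (Y : ι → Matrix (Fin 3) (Fin 3) ℂ)
    (X Z W : Matrix (Fin 3) (Fin 3) ℂ) :
    cyc X (∑ i ∈ s, c i • Y i) Z W = ∑ i ∈ s, c i * cyc X (Y i) Z W := by
  simp [cyc, Matrix.sum_mul, Matrix.mul_sum, trace_sum]

lemma cyc_sum₃ {ι : Type*} (s : Finset ι) (c : ι → ℂ) (Z : ι → Matrix (Fin 3) (Fin 3) ℂ)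
    (X Y W : Matrix (Fin 3) (Fin 3) ℂ) :
    cyc X Y (∑ i ∈ s, c i • Z i) W = ∑ i ∈ s, c i * cyc X Y (Z i) W := by
  simp [cyc, Matrix.sum_mul, Matrix.mul_sum, trace_sum]

lemma cyc_sum₄ {ι : Type*} (s : Finset ι) (c : ι → ℂ) (W : ι → Matrix (Fin 3) (Fin 3) ℂ)
    (X Y Z : Matrix (Fin 3) (Fin 3) ℂ) :
    cyc X Y Z (∑ i ∈ s, c i • W i) = ∑ i ∈ s, c i * cyc X Y Z (W i) := by
  simp [cyc, transpose_sum, Matrix.mul_sum, trace_sum]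

lemma cyc_congr_act (m X Y Z W : Matrix (Fin 3) (Fin 3) ℂ) :
    cyc (mᵀ * X * m) Y (mᵀ * Z * m) W = cyc X (m * Y * mᵀ) Z (m * W * mᵀ) := by
  simp only [cyc, transpose_mul, transpose_transpose]
  rw [show mᵀ * (Xᵀ * m) * Y * (mᵀ * Z * m) * Wᵀ
    = mᵀ * (Xᵀ * m * Y * mᵀ * Z * m * Wᵀ) by simp only [Matrix.mul_assoc], trace_mul_comm]
  simp only [Matrix.mul_assoc]

/-- The slice `ε^{··k}` of the antisymmetric symbol. -/
def epsSlice (k : Fin 3) : Matrix (Fin 3) (Fin 3) ℂ := of fun p r => eps3 p r k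

lemma sum_smul_congr_epsSlice (m : Matrix (Fin 3) (Fin 3) ℂ) (K : Fin 3) :
    ∑ k, m K k • (m * epsSlice k * mᵀ) = m.det • epsSlice K := by
  ext i j
  fin_cases K <;> fin_cases i <;> fin_cases j <;>
    simp [Matrix.sum_apply, mul_apply, Fin.sum_univ_three, epsSlice, eps3, det_fin_three] <;> ring

lemma sum_smul_sum_smul {V : Type*} [AddCommGroup V] [Module ℂ V]
    {m n : Matrix (Fin 3) (Fin 3) ℂ} (h : n * m = 1) (k : Fin 3) (v : Fin 3 → V) :
    ∑ K, n k K • ∑ l, m K l • v l = v k := by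
  simp only [smul_sum, smul_smul]
  rw [sum_comm]
  simp only [← sum_smul, ← mul_apply, h, one_apply, ite_smul, one_smul, zero_smul,
    sum_ite_eq, mem_univ, if_true]

lemma congr_epsSlice {m n : Matrix (Fin 3) (Fin 3) ℂ} (h : n * m = 1) (k : Fin 3) :
    m * epsSlice k * mᵀ = ∑ K, (m.det * n k K) • epsSlice K := by
  rw [← sum_smul_sum_smul h k fun l => m * epsSlice l * mᵀ]
  simp only [sum_smul_congr_epsSlice, smul_smul, mul_comm]

lemma actT_slice_right (m : Matrix (Fin 3) (Fin 3) ℂ) (a : Fin 3 → Fin 3 → Fin 3 → ℂ)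
    (i : Fin 3) :
    (of fun p q => actT m a p q i) = mᵀ * (∑ I, m I i • of fun p q => a p q I) * m := by
  simp only [Matrix.mul_sum, Matrix.sum_mul, Matrix.mul_smul, Matrix.smul_mul]
  ext p q
  simp only [of_apply, actT, Matrix.sum_apply, Matrix.smul_apply, mul_apply, transpose_apply,
    Fin.sum_univ_three, smul_eq_mul]
  ring

lemma actT_slice_left (m : Matrix (Fin 3) (Fin 3) ℂ) (a : Fin 3 → Fin 3 → Fin 3 → ℂ)
    (r : Fin 3) :
    (of fun t s => actT m a r s t) = mᵀ * (∑ R, m R r • of fun t s => a R s t) * m := by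
  simp only [Matrix.mul_sum, Matrix.sum_mul, Matrix.mul_smul, Matrix.smul_mul]
  ext t s
  simp only [of_apply, actT, Matrix.sum_apply, Matrix.smul_apply, mul_apply, transpose_apply,
    Fin.sum_univ_three, smul_eq_mul]
  ring

lemma bT_eq_cyc (a : Fin 3 → Fin 3 → Fin 3 → ℂ) (i j k l : Fin 3) :
    bT a i j k l = cyc (of fun p q => a p q i) (epsSlice k) (of fun p q => a p q j)
      (epsSlice l) := by
  simp only [cyc_eq_sum, bT, epsSlice, of_apply]

lemma eps3_swap (i j k : Fin 3) : eps3 i j k = -eps3 i k j := by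
  fin_cases i <;> fin_cases j <;> fin_cases k <;> simp [eps3]

lemma dT_eq_cyc (a : Fin 3 → Fin 3 → Fin 3 → ℂ) (i j k : Fin 3) :
    dT a i j k = -∑ r, cyc (of fun p q => bT a p q i r) (epsSlice k) (of fun t s => a r s t)
      (epsSlice j) := by
  simp only [cyc_eq_sum, dT, epsSlice, of_apply, eps3_swap _ j, ← sum_neg_distrib]
  simp only [Fin.sum_univ_three]
  ring

/-- `b` as a matrix from pairs of upper indices to pairs of lower indices. -/
def bMat (a : Fin 3 → Fin 3 → Fin 3 → ℂ) : Matrix (Fin 3 × Fin 3) (Fin 3 × Fin 3) ℂ :=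
  of fun x y => bT a x.1 x.2 y.1 y.2

lemma bT_actT {m n : Matrix (Fin 3) (Fin 3) ℂ} (h : n * m = 1)
    (a : Fin 3 → Fin 3 → Fin 3 → ℂ) (i j k l : Fin 3) :
    bT (actT m a) i j k l = ∑ K, ∑ L, ∑ I, ∑ J,
      m.det ^ 2 * (n k K * n l L) * (m I i * m J j) * bT a I J K L := by
  rw [bT_eq_cyc, actT_slice_right, actT_slice_right, cyc_congr_act, congr_epsSlice h,
    congr_epsSlice h, cyc_sum₂]
  simp_rw [cyc_sum₄, cyc_sum₁, cyc_sum₃, ← bT_eq_cyc, mul_sum]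
  refine sum_congr rfl fun K _ => sum_congr rfl fun L _ => sum_congr rfl fun I _ =>
    sum_congr rfl fun J _ => ?_
  ring

lemma bMat_actT {m n : Matrix (Fin 3) (Fin 3) ℂ} (h : n * m = 1)
    (a : Fin 3 → Fin 3 → Fin 3 → ℂ) :
    bMat (actT m a) = m.det ^ 2 • ((m ⊗ₖ m)ᵀ * bMat a * (n ⊗ₖ n)ᵀ) := by
  ext ⟨i, j⟩ ⟨k, l⟩
  simp only [bMat, of_apply, bT_actT h, Matrix.smul_apply, mul_apply, transpose_apply,
    Fintype.sum_prod_type, kroneckerMap_apply, smul_eq_mul, mul_sum, sum_mul]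
  refine sum_congr rfl fun K _ => sum_congr rfl fun L _ => sum_congr rfl fun I _ =>
    sum_congr rfl fun J _ => ?_
  ring

lemma bT_slice_actT {m n : Matrix (Fin 3) (Fin 3) ℂ} (h : n * m = 1)
    (a : Fin 3 → Fin 3 → Fin 3 → ℂ) (k l : Fin 3) :
    (of fun i j => bT (actT m a) i j k l) = mᵀ * (∑ L, n l L • ∑ K, (m.det ^ 2 * n k K) •
      of fun i j => bT a i j K L) * m := by
  simp only [Matrix.mul_sum, Matrix.sum_mul, Matrix.mul_smul, Matrix.smul_mul]
  ext i j
  simp only [of_apply, bT_actT h, Matrix.smul_apply, Matrix.sum_apply, mul_apply,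
    transpose_apply, smul_eq_mul, mul_sum, sum_mul]
  rw [sum_comm]
  refine sum_congr rfl fun L _ => sum_congr rfl fun K _ => ?_
  rw [sum_comm]
  refine sum_congr rfl fun J _ => sum_congr rfl fun I _ => ?_
  ring

lemma sum_cyc_contract {m n : Matrix (Fin 3) (Fin 3) ℂ} (h : m * n = 1)
    (X Z : Fin 3 → Matrix (Fin 3) (Fin 3) ℂ) (Y W : Matrix (Fin 3) (Fin 3) ℂ) :
    ∑ r, cyc (∑ R, n r R • X R) Y (∑ S, m S r • Z S) W = ∑ R, cyc (X R) Y (Z R) W := by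
  have ht : nᵀ * mᵀ = 1 := by rw [← transpose_mul, h, transpose_one]
  simp_rw [cyc_sum₁]
  rw [sum_comm]
  refine sum_congr rfl fun R _ => ?_
  rw [← cyc_sum₃]
  exact congrArg (cyc (X R) Y · W) (sum_smul_sum_smul ht R Z)

lemma JT_eq_trace (a : Fin 3 → Fin 3 → Fin 3 → ℂ) : JT a = trace (bMat a * bMat a) := by
  simp only [JT, bMat, trace, diag_apply, mul_apply, Fintype.sum_prod_type, of_apply]

lemma transpose_kronecker_mul_transpose_kronecker {m n : Matrix (Fin 3) (Fin 3) ℂ}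
    (h : m * n = 1) : (n ⊗ₖ n)ᵀ * (m ⊗ₖ m)ᵀ = 1 := by
  rw [← transpose_mul, ← mul_kronecker_mul, h, one_kronecker_one, transpose_one]

lemma JT_actT {m n : Matrix (Fin 3) (Fin 3) ℂ} (h : n * m = 1)
    (a : Fin 3 → Fin 3 → Fin 3 → ℂ) : JT (actT m a) = m.det ^ 4 * JT a := by
  have hk := transpose_kronecker_mul_transpose_kronecker (mul_eq_one_comm.mp h)
  rw [JT_eq_trace, JT_eq_trace, bMat_actT h]
  simp only [Matrix.smul_mul, Matrix.mul_smul, smul_smul, trace_smul, smul_eq_mul]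
  rw [show (m ⊗ₖ m)ᵀ * bMat a * (n ⊗ₖ n)ᵀ * ((m ⊗ₖ m)ᵀ * bMat a * (n ⊗ₖ n)ᵀ)
    = (m ⊗ₖ m)ᵀ * (bMat a * ((n ⊗ₖ n)ᵀ * (m ⊗ₖ m)ᵀ) * bMat a * (n ⊗ₖ n)ᵀ) by
      simp only [Matrix.mul_assoc],
    trace_mul_comm, Matrix.mul_assoc, hk, Matrix.mul_one, Matrix.mul_one]
  ring

/-- `c` as a matrix with rows indexed by its first two indices. -/
def cMat (a : Fin 3 → Fin 3 → Fin 3 → ℂ) : Matrix (Fin 3 × Fin 3) (Fin 3) ℂ :=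
  of fun x k => cT a x.1 x.2 k

/-- `d` as a matrix with rows indexed by its first two indices. -/
def dMat (a : Fin 3 → Fin 3 → Fin 3 → ℂ) : Matrix (Fin 3 × Fin 3) (Fin 3) ℂ :=
  of fun x k => dT a x.1 x.2 k

/-- A ternary tensor as a matrix with rows indexed by its first two indices. -/
def tensorMat (a : Fin 3 → Fin 3 → Fin 3 → ℂ) : Matrix (Fin 3 × Fin 3) (Fin 3) ℂ :=
  of fun x k => a x.1 x.2 k

lemma cMat_eq_mul (a : Fin 3 → Fin 3 → Fin 3 → ℂ) : cMat a = bMat a * tensorMat a := by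
  ext ⟨i, j⟩ k
  simp only [cMat, cT, bMat, tensorMat, mul_apply, Fintype.sum_prod_type, of_apply]

lemma tensorMat_actT (m : Matrix (Fin 3) (Fin 3) ℂ) (a : Fin 3 → Fin 3 → Fin 3 → ℂ) :
    tensorMat (actT m a) = (m ⊗ₖ m)ᵀ * tensorMat a * m := by
  ext ⟨i, j⟩ k
  simp only [tensorMat, actT, mul_apply, Fintype.sum_prod_type, of_apply, transpose_apply,
    kroneckerMap_apply, Fin.sum_univ_three]
  ring

lemma cMat_actT {m n : Matrix (Fin 3) (Fin 3) ℂ} (h : n * m = 1)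
    (a : Fin 3 → Fin 3 → Fin 3 → ℂ) :
    cMat (actT m a) = m.det ^ 2 • ((m ⊗ₖ m)ᵀ * cMat a * m) := by
  have hk := transpose_kronecker_mul_transpose_kronecker (mul_eq_one_comm.mp h)
  rw [cMat_eq_mul, cMat_eq_mul, bMat_actT h, tensorMat_actT, Matrix.smul_mul]
  simp only [Matrix.mul_assoc]
  rw [← Matrix.mul_assoc (n ⊗ₖ n)ᵀ, hk, Matrix.one_mul]

lemma dT_actT {m n : Matrix (Fin 3) (Fin 3) ℂ} (h : n * m = 1)
    (a : Fin 3 → Fin 3 → Fin 3 → ℂ) (i j k : Fin 3) :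
    dT (actT m a) i j k = ∑ K, ∑ I, ∑ J,
      m.det ^ 4 * (n i I * n j J) * n k K * dT a I J K := by
  simp_rw [dT_eq_cyc, bT_slice_actT h, actT_slice_left, cyc_congr_act, congr_epsSlice h]
  rw [sum_cyc_contract (mul_eq_one_comm.mp h)]
  simp_rw [cyc_sum₂, cyc_sum₁, cyc_sum₄, mul_neg, sum_neg_distrib, mul_sum]
  rw [sum_comm]
  refine congrArg _ (sum_congr rfl fun K _ => ?_)
  rw [sum_comm]
  refine sum_congr rfl fun I _ => ?_
  rw [sum_comm]
  refine sum_congr rfl fun J _ => sum_congr rfl fun R _ => ?_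
  ring

lemma dMat_actT {m n : Matrix (Fin 3) (Fin 3) ℂ} (h : n * m = 1)
    (a : Fin 3 → Fin 3 → Fin 3 → ℂ) :
    dMat (actT m a) = m.det ^ 4 • ((n ⊗ₖ n) * dMat a * nᵀ) := by
  ext ⟨i, j⟩ k
  simp only [dMat, of_apply, dT_actT h, Matrix.smul_apply, mul_apply, transpose_apply,
    Fintype.sum_prod_type, kroneckerMap_apply, smul_eq_mul, mul_sum, sum_mul]
  refine sum_congr rfl fun K _ => sum_congr rfl fun I _ => sum_congr rfl fun J _ => ?_
  ring

lemma KT_eq_trace (a : Fin 3 → Fin 3 → Fin 3 → ℂ) : KT a = trace (cMat a * (dMat a)ᵀ) := by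
  simp only [KT, cMat, dMat, trace, diag_apply, mul_apply, Fintype.sum_prod_type, of_apply,
    transpose_apply]

lemma KT_actT {m n : Matrix (Fin 3) (Fin 3) ℂ} (h : n * m = 1)
    (a : Fin 3 → Fin 3 → Fin 3 → ℂ) : KT (actT m a) = m.det ^ 6 * KT a := by
  have hk := transpose_kronecker_mul_transpose_kronecker (mul_eq_one_comm.mp h)
  rw [KT_eq_trace, KT_eq_trace, cMat_actT h, dMat_actT h]
  simp only [Matrix.smul_mul, Matrix.mul_smul, smul_smul, trace_smul, smul_eq_mul,
    transpose_smul, transpose_mul, transpose_transpose]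
  rw [show (m ⊗ₖ m)ᵀ * cMat a * m * (n * ((dMat a)ᵀ * (n ⊗ₖ n)ᵀ))
    = (m ⊗ₖ m)ᵀ * (cMat a * (m * n) * (dMat a)ᵀ * (n ⊗ₖ n)ᵀ) by simp only [Matrix.mul_assoc],
    trace_mul_comm, Matrix.mul_assoc, hk, mul_eq_one_comm.mp h, Matrix.mul_one, Matrix.mul_one]
  ring

/-- The ratio `J³/(J³ − 6K²)` of a ternary cubic is coordinate-independent:
`J(m·a)³ · (J(a)³ − 6K(a)²) = J(a)³ · (J(m·a)³ − 6K(m·a)²)`. -/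
theorem statement3 (a : Fin 3 → Fin 3 → Fin 3 → ℂ) (ha : SymT a)
    (m : Matrix (Fin 3) (Fin 3) ℂ) (hm : IsUnit m.det) :
    JT (actT m a) ^ 3 * (JT a ^ 3 - 6 * KT a ^ 2)
      = JT a ^ 3 * (JT (actT m a) ^ 3 - 6 * KT (actT m a) ^ 2) := by
  have h := nonsing_inv_mul m hm
  rw [JT_actT h, KT_actT h]
  ring
end
end

section
/- Let t ∈ ℂ and let a(t) be the symmetric tensor of the ternary cubic x³ + y³ + z³ + txyz, namely a_{111} = a_{222} = a_{333} = 1, a_{ijk} = t/6 whenever {i,j,k} = {1,2,3}, and all other entries zero. Then J(a(t)) = t(t³ − 216)/54. -/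
noncomputable section
open Finset

/-- The symmetric tensor of the ternary cubic `x³ + y³ + z³ + txyz`:
`a_{111} = a_{222} = a_{333} = 1`, `a_{ijk} = t/6` whenever `{i,j,k} = {1,2,3}`
(here indices `0,1,2` of `Fin 3`), all other entries zero. -/
def aFermat (t : ℂ) : Fin 3 → Fin 3 → Fin 3 → ℂ := fun i j k =>
  if (i, j, k) = (0, 0, 0) ∨ (i, j, k) = (1, 1, 1) ∨ (i, j, k) = (2, 2, 2) then 1
  else if (i, j, k) = (0, 1, 2) ∨ (i, j, k) = (1, 2, 0) ∨ (i, j, k) = (2, 0, 1)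
      ∨ (i, j, k) = (0, 2, 1) ∨ (i, j, k) = (2, 1, 0) ∨ (i, j, k) = (1, 0, 2) then t / 6
  else 0

/-- Contracting two indices with `eps3` antisymmetrizes over the two indices that follow the
free one cyclically. -/
theorem sum_mul_eps3 (f : Fin 3 → Fin 3 → ℂ) (k : Fin 3) :
    ∑ p, ∑ r, f p r * eps3 p r k = f (k + 1) (k + 2) - f (k + 2) (k + 1) := by
  fin_cases k <;> simp [Fin.sum_univ_three, eps3] <;> ring

theorem bT_eq (a : Fin 3 → Fin 3 → Fin 3 → ℂ) (i j k l : Fin 3) :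
    bT a i j k l =
      a (k + 1) (l + 1) i * a (k + 2) (l + 2) j - a (k + 1) (l + 2) i * a (k + 2) (l + 1) j
      - (a (k + 2) (l + 1) i * a (k + 1) (l + 2) j
        - a (k + 2) (l + 2) i * a (k + 1) (l + 1) j) := by
  have inner (p r : Fin 3) :
      ∑ q, ∑ s, a p q i * a r s j * eps3 p r k * eps3 q s l =
        (a p (l + 1) i * a r (l + 2) j - a p (l + 2) i * a r (l + 1) j) * eps3 p r k := by
    rw [sum_mul_eps3 (fun q s => a p q i * a r s j * eps3 p r k)]
    ring
  rw [← sum_mul_eps3 (fun p r => a p (l + 1) i * a r (l + 2) j - a p (l + 2) i * a r (l + 1) j)]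
  unfold bT
  refine sum_congr rfl fun p _ => ?_
  rw [sum_comm]
  exact sum_congr rfl fun r _ => inner p r

/-- For the ternary cubic `x³ + y³ + z³ + txyz` one has `J = t(t³ − 216)/54`. -/
theorem statement5 (t : ℂ) : JT (aFermat t) = t * (t ^ 3 - 216) / 54 := by
  simp [JT, bT_eq, Fin.sum_univ_three, aFermat]
  ring
end
end

section
/- Let t ∈ ℂ and let a(t) be the symmetric tensor of the ternary cubic F_t(X,Y,Z) = tX³ + tY³ + tZ³ − 18XYZ. Then, with J = J(a(t)) and K = K(a(t)), one has the identity 1728·(t³+27)³·(J³ − 6K²)·t³·(t³−216)³ = −(t³(t³−216)³)²·J³; equivalently, for t³+27 ≠ 0 and J ≠ 0, (J³ − 6K²)/J³ = −t³(t³−216)³/(1728(t³+27)³), so the elliptic curves defined by F_t and by x³+y³+z³+txyz have reciprocal j-invariants. -/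
noncomputable section
open Finset

/-- The symmetric tensor of the ternary cubic
`F_t(X,Y,Z) = tX³ + tY³ + tZ³ − 18XYZ`,
with `X,Y,Z` corresponding to the indices `0,1,2`. -/
def aF (t : ℂ) : Fin 3 → Fin 3 → Fin 3 → ℂ := fun i j k =>
  if (i, j, k) = (0, 0, 0) ∨ (i, j, k) = (1, 1, 1) ∨ (i, j, k) = (2, 2, 2) then t
  else if (i, j, k) = (0, 1, 2) ∨ (i, j, k) = (1, 2, 0) ∨ (i, j, k) = (2, 0, 1)
      ∨ (i, j, k) = (0, 2, 1) ∨ (i, j, k) = (2, 1, 0) ∨ (i, j, k) = (1, 0, 2) then -3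
  else 0

/-- The tensor `b` of `F_t` in closed form. -/
def bF (t : ℂ) (i j k l : Fin 3) : ℂ :=
  if i = j then
    if k = l then (if k = i then -18 else 0) else (if k ≠ i ∧ l ≠ i then 6 * t else 0)
  else
    if k = l then (if k ≠ i ∧ k ≠ j then t ^ 2 else 0)
    else (if (k = i ∧ l = j) ∨ (k = j ∧ l = i) then 9 else 0)

/-- The symmetric tensor with diagonal entries `x`, entries `y` at triples of distinct indices,
and zeros elsewhere. -/
def hesseTensor (x y : ℂ) (i j k : Fin 3) : ℂ :=
  if i = j ∧ j = k then x else if i ≠ j ∧ j ≠ k ∧ i ≠ k then y else 0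

lemma bT_aF (t : ℂ) (i j k l : Fin 3) : bT (aF t) i j k l = bF t i j k l := by
  fin_cases i <;> fin_cases j <;> fin_cases k <;> fin_cases l <;>
    simp [bT, bF, Fin.sum_univ_three, aF, eps3] <;> ring

lemma cT_aF (t : ℂ) (i j k : Fin 3) :
    cT (aF t) i j k = hesseTensor (-54 * t) (t ^ 3 - 54) i j k := by
  simp only [cT, bT_aF]
  fin_cases i <;> fin_cases j <;> fin_cases k <;>
    simp [hesseTensor, bF, Fin.sum_univ_three, aF] <;> ring

lemma dT_aF (t : ℂ) (i j k : Fin 3) :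
    dT (aF t) i j k = hesseTensor (-18 * t ^ 2) (t ^ 3 + 108) i j k := by
  simp only [dT, bT_aF]
  fin_cases i <;> fin_cases j <;> fin_cases k <;>
    simp [hesseTensor, bF, Fin.sum_univ_three, aF, eps3] <;> ring

lemma JT_aF (t : ℂ) : JT (aF t) = 72 * (t ^ 3 + 27) := by
  simp only [JT, bT_aF]
  simp [bF, Fin.sum_univ_three]
  ring

lemma KT_aF (t : ℂ) : KT (aF t) = 6 * t ^ 6 + 3240 * t ^ 3 - 34992 := by
  simp only [KT, cT_aF, dT_aF]
  simp [hesseTensor, Fin.sum_univ_three]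
  ring

/-- For the ternary cubic `F_t = tX³ + tY³ + tZ³ − 18XYZ` one has the identity
`1728(t³+27)³(J³ − 6K²)·t³(t³−216)³ = −(t³(t³−216)³)²·J³`; equivalently, for
`t³+27 ≠ 0` and `J ≠ 0`, `(J³ − 6K²)/J³ = −t³(t³−216)³/(1728(t³+27)³)`, so the
elliptic curves defined by `F_t` and by `x³+y³+z³+txyz` have reciprocal
`j`-invariants. -/
theorem statement8 (t : ℂ) :
    1728 * (t ^ 3 + 27) ^ 3 * (JT (aF t) ^ 3 - 6 * KT (aF t) ^ 2)
          * t ^ 3 * (t ^ 3 - 216) ^ 3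
        = -(t ^ 3 * (t ^ 3 - 216) ^ 3) ^ 2 * JT (aF t) ^ 3
      ∧ (t ^ 3 + 27 ≠ 0 → JT (aF t) ≠ 0 →
          (JT (aF t) ^ 3 - 6 * KT (aF t) ^ 2) / JT (aF t) ^ 3
            = -(t ^ 3 * (t ^ 3 - 216) ^ 3) / (1728 * (t ^ 3 + 27) ^ 3)) := by
  have hdisc : JT (aF t) ^ 3 - 6 * KT (aF t) ^ 2 = -216 * (t ^ 3 * (t ^ 3 - 216) ^ 3) := by
    rw [JT_aF, KT_aF]
    ring
  rw [hdisc, JT_aF]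
  refine ⟨by ring, fun ht _ => ?_⟩
  field_simp
  ring
end
end

section
/- For every symmetric tensor a : (Fin 2)⁴ → ℂ and every m ∈ GL(2,ℂ), the binary quartic invariants satisfy J(m·a) = (det m)⁴ · J(a) and K(m·a) = (det m)⁶ · K(a), where (m·a)_{ijkl} = Σ_{p,q,r,s} a_{pqrs} m^p_i m^q_j m^r_k m^s_l. -/
noncomputable section
open Finset

/-- The antisymmetric symbol on two indices with `ε^{12} = 1 = −ε^{21}`
(indices `0,1` in `Fin 2`). -/
def eps2 : Fin 2 → Fin 2 → ℂ := fun i j =>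
  if (i, j) = (0, 1) then 1 else if (i, j) = (1, 0) then -1 else 0

/-- The partial contraction `b_{ij}^{kl} = Σ a_{ijpq} ε^{pk} ε^{ql}` of a
binary quartic tensor. -/
def bQ (a : Fin 2 → Fin 2 → Fin 2 → Fin 2 → ℂ) (i j k l : Fin 2) : ℂ :=
  ∑ p : Fin 2, ∑ q : Fin 2, a i j p q * eps2 p k * eps2 q l

/-- The degree-2 invariant `J = Σ b_{ij}^{kl} b_{kl}^{ij}` of a binary quartic. -/
def JQ (a : Fin 2 → Fin 2 → Fin 2 → Fin 2 → ℂ) : ℂ :=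
  ∑ i : Fin 2, ∑ j : Fin 2, ∑ k : Fin 2, ∑ l : Fin 2, bQ a i j k l * bQ a k l i j

/-- The degree-3 invariant `K = Σ b_{ij}^{kl} b_{kl}^{mn} b_{mn}^{ij}` of a
binary quartic. -/
def KQ (a : Fin 2 → Fin 2 → Fin 2 → Fin 2 → ℂ) : ℂ :=
  ∑ i : Fin 2, ∑ j : Fin 2, ∑ k : Fin 2, ∑ l : Fin 2, ∑ m : Fin 2, ∑ n : Fin 2,
    bQ a i j k l * bQ a k l m n * bQ a m n i j

/-- A binary quartic tensor is symmetric if invariant under permutations of its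
indices. -/
def SymQ (a : Fin 2 → Fin 2 → Fin 2 → Fin 2 → ℂ) : Prop :=
  ∀ i j k l : Fin 2, a i j k l = a j i k l ∧ a i j k l = a i k j l ∧ a i j k l = a i j l k

/-- The substitution action
`(m·a)_{ijkl} = Σ_{p,q,r,s} a_{pqrs} m^p_i m^q_j m^r_k m^s_l`. -/
def actQ (m : Matrix (Fin 2) (Fin 2) ℂ) (a : Fin 2 → Fin 2 → Fin 2 → Fin 2 → ℂ) :
    Fin 2 → Fin 2 → Fin 2 → Fin 2 → ℂ := fun i j k l =>
  ∑ p : Fin 2, ∑ q : Fin 2, ∑ r : Fin 2, ∑ s : Fin 2,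
    a p q r s * m p i * m q j * m r k * m s l

/-- A symmetric binary quartic tensor is determined by the entries with weakly increasing indices. -/
lemma SymQ.eq_sorted {a : Fin 2 → Fin 2 → Fin 2 → Fin 2 → ℂ} (ha : SymQ a) :
    (a 0 0 1 0 = a 0 0 0 1 ∧ a 0 1 0 0 = a 0 0 0 1 ∧ a 1 0 0 0 = a 0 0 0 1) ∧
    (a 0 1 0 1 = a 0 0 1 1 ∧ a 0 1 1 0 = a 0 0 1 1 ∧ a 1 0 0 1 = a 0 0 1 1 ∧
      a 1 0 1 0 = a 0 0 1 1 ∧ a 1 1 0 0 = a 0 0 1 1) ∧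
    (a 1 0 1 1 = a 0 1 1 1 ∧ a 1 1 0 1 = a 0 1 1 1 ∧ a 1 1 1 0 = a 0 1 1 1) := by
  simp only [SymQ, Fin.forall_fin_two] at ha
  grind

/-- The substitution action preserves symmetry. -/
lemma SymQ.actQ {a : Fin 2 → Fin 2 → Fin 2 → Fin 2 → ℂ} (ha : SymQ a)
    (m : Matrix (Fin 2) (Fin 2) ℂ) : SymQ (actQ m a) := by
  obtain ⟨⟨h₁, h₂, h₃⟩, ⟨h₄, h₅, h₆, h₇, h₈⟩, h₉, h₁₀, h₁₁⟩ := ha.eq_sorted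
  intro i j k l
  simp only [_root_.actQ, Fin.sum_univ_two, h₁, h₂, h₃, h₄, h₅, h₆, h₇, h₈, h₉, h₁₀, h₁₁]
  refine ⟨?_, ?_, ?_⟩ <;> ring

/-- `J` in terms of the five coefficients of a binary quartic. -/
lemma SymQ.JQ_eq {a : Fin 2 → Fin 2 → Fin 2 → Fin 2 → ℂ} (ha : SymQ a) :
    JQ a = 2 * (a 0 0 0 0 * a 1 1 1 1 - 4 * a 0 0 0 1 * a 0 1 1 1 + 3 * a 0 0 1 1 ^ 2) := by
  obtain ⟨⟨h₁, h₂, h₃⟩, ⟨h₄, h₅, h₆, h₇, h₈⟩, h₉, h₁₀, h₁₁⟩ := ha.eq_sorted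
  simp [JQ, bQ, eps2, Fin.sum_univ_two, h₁, h₂, h₃, h₄, h₅, h₆, h₇, h₈, h₉, h₁₀, h₁₁]
  ring

/-- `K` in terms of the five coefficients of a binary quartic. -/
lemma SymQ.KQ_eq {a : Fin 2 → Fin 2 → Fin 2 → Fin 2 → ℂ} (ha : SymQ a) :
    KQ a = 6 * (a 0 0 0 0 * a 0 0 1 1 * a 1 1 1 1 + 2 * a 0 0 0 1 * a 0 0 1 1 * a 0 1 1 1
      - a 0 0 1 1 ^ 3 - a 0 0 0 0 * a 0 1 1 1 ^ 2 - a 0 0 0 1 ^ 2 * a 1 1 1 1) := by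
  obtain ⟨⟨h₁, h₂, h₃⟩, ⟨h₄, h₅, h₆, h₇, h₈⟩, h₉, h₁₀, h₁₁⟩ := ha.eq_sorted
  simp [KQ, bQ, eps2, Fin.sum_univ_two, h₁, h₂, h₃, h₄, h₅, h₆, h₇, h₈, h₉, h₁₀, h₁₁]
  ring

set_option maxHeartbeats 2000000 in
/-- For every symmetric binary quartic tensor `a` and every `m ∈ GL(2,ℂ)`,
`J(m·a) = (det m)⁴ J(a)` and `K(m·a) = (det m)⁶ K(a)`. -/
theorem statement12 (a : Fin 2 → Fin 2 → Fin 2 → Fin 2 → ℂ) (ha : SymQ a)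
    (m : Matrix (Fin 2) (Fin 2) ℂ) (hm : IsUnit m.det) :
    JQ (actQ m a) = m.det ^ 4 * JQ a ∧ KQ (actQ m a) = m.det ^ 6 * KQ a := by
  rw [(ha.actQ m).JQ_eq, (ha.actQ m).KQ_eq, ha.JQ_eq, ha.KQ_eq, Matrix.det_fin_two]
  obtain ⟨⟨h₁, h₂, h₃⟩, ⟨h₄, h₅, h₆, h₇, h₈⟩, h₉, h₁₀, h₁₁⟩ := ha.eq_sorted
  simp only [actQ, Fin.sum_univ_two, h₁, h₂, h₃, h₄, h₅, h₆, h₇, h₈, h₉, h₁₀, h₁₁]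
  constructor <;> ring
end
end

section
/- Let t ∈ ℂ and let a(t) be the symmetric tensor of the binary quartic p(X,Y) = tX⁴ − 12X²Y² + tY⁴ (the polynomial representing the multiplication ⨀⁴𝔪/𝔪² → 𝔪⁴ in the moduli algebra of the Ẽ₇ singularity x⁴+tx²y²+y⁴+z²=0). Then, with J = J(a(t)) and K = K(a(t)), one has the identity 108·(t²−4)²·J³ = 6K²·(12+t²)³ for all t ∈ ℂ; in particular for t² ≠ 4 and K ≠ 0, J³/(6K²) = (12+t²)³/(108(t²−4)²), recovering Saito's j-invariant of Ẽ₇. -/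
noncomputable section
open Finset

/-- The symmetric tensor of the binary quartic `p(X,Y) = tX⁴ − 12X²Y² + tY⁴`,
the polynomial representing the multiplication `⨀⁴𝔪/𝔪² → 𝔪⁴` in the moduli
algebra of the `Ẽ₇` singularity `x⁴+tx²y²+y⁴+z² = 0`
(`X` corresponds to index `0`, `Y` to index `1`). -/
def aQmod (t : ℂ) : Fin 2 → Fin 2 → Fin 2 → Fin 2 → ℂ := fun i j k m =>
  if i.val + j.val + k.val + m.val = 0 then t
  else if i.val + j.val + k.val + m.val = 2 then -12 / 6
  else if i.val + j.val + k.val + m.val = 4 then t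
  else 0

theorem JQ_aQmod (t : ℂ) : JQ (aQmod t) = 2 * (12 + t ^ 2) := by
  simp [JQ, bQ, aQmod, eps2, Fin.sum_univ_two]
  ring

theorem KQ_aQmod (t : ℂ) : KQ (aQmod t) = 12 * (4 - t ^ 2) := by
  simp [KQ, bQ, aQmod, eps2, Fin.sum_univ_two]
  ring

/-- For the binary quartic `tX⁴ − 12X²Y² + tY⁴` one has
`108(t²−4)²J³ = 6K²(12+t²)³`; in particular for `t² ≠ 4` and `K ≠ 0`,
`J³/(6K²) = (12+t²)³/(108(t²−4)²)`, recovering Saito's `j`-invariant of `Ẽ₇`. -/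
theorem statement15 (t : ℂ) :
    108 * (t ^ 2 - 4) ^ 2 * JQ (aQmod t) ^ 3
        = 6 * KQ (aQmod t) ^ 2 * (12 + t ^ 2) ^ 3
      ∧ (t ^ 2 ≠ 4 → KQ (aQmod t) ≠ 0 →
          JQ (aQmod t) ^ 3 / (6 * KQ (aQmod t) ^ 2)
            = (12 + t ^ 2) ^ 3 / (108 * (t ^ 2 - 4) ^ 2)) := by
  rw [JQ_aQmod, KQ_aQmod]
  refine ⟨by ring, fun ht _ => ?_⟩
  have h : t ^ 2 - 4 ≠ 0 := sub_ne_zero.mpr ht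
  have h_neg : 4 - t ^ 2 ≠ 0 := sub_ne_zero.mpr ht.symm
  field_simp
  ring
end
end

section
/- Let t ∈ ℂ with 4t³ + 27 ≠ 0, and let A_t = ℂ[x,y]/(3y² + tx⁴, 3x⁵ + 2tx³y) be the moduli algebra of the Ẽ₈ singularity x⁶ + tx⁴y + y³ + z² = 0. Then the set {v ∈ A_t : v⁴ = 0} is exactly the ideal of A_t generated by the images of y and x². -/
noncomputable section
open MvPolynomial

/-- The ideal `(3y² + tx⁴, 3x⁵ + 2tx³y)` of `ℂ[x,y]`, with `x = X 0`, `y = X 1`. -/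
def IE8 (t : ℂ) : Ideal (MvPolynomial (Fin 2) ℂ) :=
  Ideal.span {3 * X 1 ^ 2 + C t * X 0 ^ 4, 3 * X 0 ^ 5 + 2 * C t * X 0 ^ 3 * X 1}

/-- If `4τ³ + 27` and `3` are invertible, the relations of `A_t` force every element of the
ideal `(y, x²)` to have vanishing fourth power. -/
theorem pow_four_eq_zero_of_relations {R : Type*} [CommRing R] {x y τ u k : R}
    (h₁ : 3 * y ^ 2 + τ * x ^ 4 = 0) (h₂ : 3 * x ^ 5 + 2 * τ * x ^ 3 * y = 0)
    (hu : u * (4 * τ ^ 3 + 27) = 1) (hk : k * 3 = 1) (a b : R) :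
    (a * y + b * x ^ 2) ^ 4 = 0 := by
  have hx : x ^ 7 = 0 := by
    linear_combination u * (9 * x ^ 2 - 6 * τ * y) * h₂ + u * 4 * τ ^ 2 * x ^ 3 * h₁ - x ^ 7 * hu
  have hy : y ^ 2 = -(k * τ * x ^ 4) := by
    linear_combination k * h₁ - y ^ 2 * hk
  have hxy : x ^ 6 * y = 0 := by
    linear_combination k * x * y * h₂ - x ^ 6 * y * hk - 2 * k * τ * x ^ 4 * hy
      + 2 * k ^ 2 * τ ^ 2 * x * hx
  have e₄ : y ^ 4 = 0 := by
    linear_combination (y ^ 2 - k * τ * x ^ 4) * hy + k ^ 2 * τ ^ 2 * x * hx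
  have e₃ : y ^ 3 * x ^ 2 = 0 := by
    linear_combination y * x ^ 2 * hy - k * τ * hxy
  have e₂ : y ^ 2 * x ^ 4 = 0 := by
    linear_combination x ^ 4 * hy - k * τ * x * hx
  linear_combination a ^ 4 * e₄ + 4 * a ^ 3 * b * e₃ + 6 * a ^ 2 * b ^ 2 * e₂
    + 4 * a * b ^ 3 * hxy + b ^ 4 * x * hx

/-- Every polynomial in `x, y` is affine in `x` modulo `(y, x²)`. -/
theorem exists_eq_affine_add (p : MvPolynomial (Fin 2) ℂ) :
    ∃ (a b : ℂ) (q r : MvPolynomial (Fin 2) ℂ),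
      p = C a + C b * X 0 + (q * X 1 + r * X 0 ^ 2) := by
  induction p using MvPolynomial.induction_on with
  | C a => exact ⟨a, 0, 0, 0, by simp⟩
  | add p p' hp hp' =>
    obtain ⟨a, b, q, r, rfl⟩ := hp
    obtain ⟨a', b', q', r', rfl⟩ := hp'
    refine ⟨a + a', b + b', q + q', r + r', ?_⟩
    simp only [map_add]
    ring
  | mul_X p i hp =>
    obtain ⟨a, b, q, r, rfl⟩ := hp
    fin_cases i
    · refine ⟨0, a, q * X 0, C b + r * X 0, ?_⟩
      simp only [Fin.zero_eta, map_zero]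
      ring
    · refine ⟨0, 0, C a + C b * X 0 + q * X 1 + r * X 0 ^ 2, 0, ?_⟩
      simp only [Fin.mk_one, map_zero]
      ring

/-- Substituting the parabola `y = s x²` with `3s² + t = 0` sends `IE8 t` into `(x⁵)`. -/
theorem X_pow_five_dvd_aeval_of_mem_IE8 {t s : ℂ} (hs : 3 * s ^ 2 + t = 0)
    {p : MvPolynomial (Fin 2) ℂ} (hp : p ∈ IE8 t) :
    Polynomial.X ^ 5 ∣
      aeval ![(Polynomial.X : Polynomial ℂ), Polynomial.C s * Polynomial.X ^ 2] p := by
  have hs' : 3 * (Polynomial.C s) ^ 2 + Polynomial.C t = 0 := by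
    have h := congrArg Polynomial.C hs
    simpa only [map_add, map_mul, map_pow, map_ofNat, Polynomial.C_0] using h
  obtain ⟨a, b, rfl⟩ := Ideal.mem_span_pair.mp hp
  have hC : ∀ z : ℂ, algebraMap ℂ (Polynomial ℂ) z = Polynomial.C z := fun _ => rfl
  simp only [map_add, map_mul, map_pow, map_ofNat, aeval_X, aeval_C, Matrix.cons_val_zero,
    Matrix.cons_val_one, hC]
  set f := aeval (R := ℂ) ![(Polynomial.X : Polynomial ℂ), Polynomial.C s * Polynomial.X ^ 2]
  refine ⟨f b * (3 + 2 * Polynomial.C t * Polynomial.C s), ?_⟩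
  linear_combination f a * Polynomial.X ^ 4 * hs'

/-- If `X⁵` divides the fourth power of a polynomial, its two lowest coefficients vanish. -/
theorem eq_zero_of_X_pow_five_dvd_pow_four {a b : ℂ} {w : Polynomial ℂ}
    (h : Polynomial.X ^ 5 ∣
      (Polynomial.C a + Polynomial.C b * Polynomial.X + w * Polynomial.X ^ 2) ^ 4) :
    a = 0 ∧ b = 0 := by
  have ha : a = 0 := by
    have := Polynomial.prime_X.dvd_of_dvd_pow ((dvd_pow_self _ (by norm_num)).trans h)
    simpa [Polynomial.X_dvd_iff] using this
  subst ha
  refine ⟨rfl, ?_⟩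
  have h' : (Polynomial.X : Polynomial ℂ) ^ 4 * Polynomial.X ∣
      Polynomial.X ^ 4 * (Polynomial.C b + w * Polynomial.X) ^ 4 := by
    rw [Polynomial.C_0] at h
    convert h using 1 <;> ring
  have := Polynomial.prime_X.dvd_of_dvd_pow
    ((mul_dvd_mul_iff_left (pow_ne_zero 4 Polynomial.X_ne_zero)).mp h')
  simpa [Polynomial.X_dvd_iff] using this

/-- In the moduli algebra `A_t = ℂ[x,y]/(3y² + tx⁴, 3x⁵ + 2tx³y)` of the `Ẽ₈`
singularity `x⁶ + tx⁴y + y³ + z² = 0` with `4t³ + 27 ≠ 0`, the set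
`{v : v⁴ = 0}` is exactly the ideal generated by the images of `y` and `x²`. -/
theorem statement16 (t : ℂ) (ht : 4 * t ^ 3 + 27 ≠ 0) :
    ∀ v : MvPolynomial (Fin 2) ℂ ⧸ IE8 t,
      v ^ 4 = 0 ↔
        v ∈ Ideal.span {Ideal.Quotient.mk (IE8 t) (X 1),
                        Ideal.Quotient.mk (IE8 t) (X 0 ^ 2)} := by
  intro v
  constructor
  · intro hv
    obtain ⟨p, rfl⟩ := Ideal.Quotient.mk_surjective v
    rw [← map_pow, Ideal.Quotient.eq_zero_iff_mem] at hv
    obtain ⟨s, hs⟩ := IsAlgClosed.exists_pow_nat_eq (-t / 3) (n := 2) (by norm_num)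
    have hd := X_pow_five_dvd_aeval_of_mem_IE8 (s := s) (by rw [hs]; ring) hv
    obtain ⟨a, b, q, r, rfl⟩ := exists_eq_affine_add p
    set f := aeval (R := ℂ) ![(Polynomial.X : Polynomial ℂ), Polynomial.C s * Polynomial.X ^ 2] with hf
    have hab : a = 0 ∧ b = 0 := by
      apply eq_zero_of_X_pow_five_dvd_pow_four (w := f q * Polynomial.C s + f r)
      have hC : ∀ z : ℂ, f (C z) = Polynomial.C z := fun z => aeval_C _ z
      have h0 : f (X 0) = Polynomial.X := by simp [hf]
      have h1 : f (X 1) = Polynomial.C s * Polynomial.X ^ 2 := by simp [hf]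
      convert hd using 1
      simp only [map_add, map_mul, map_pow, hC, h0, h1]
      ring
    obtain ⟨rfl, rfl⟩ := hab
    exact Ideal.mem_span_pair.mpr
      ⟨Ideal.Quotient.mk _ q, Ideal.Quotient.mk _ r, by simp⟩
  · intro hv
    obtain ⟨a, b, rfl⟩ := Ideal.mem_span_pair.mp hv
    let π := Ideal.Quotient.mk (IE8 t)
    have hu : π (C (4 * t ^ 3 + 27)⁻¹) * (4 * π (C t) ^ 3 + 27) = 1 := by
      have h := congrArg (fun z => π (C z)) (inv_mul_cancel₀ ht)
      simpa only [map_mul, map_add, map_pow, map_ofNat, map_one] using h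
    have hk : π (C 3⁻¹) * 3 = 1 := by
      have h := congrArg (fun z => π (C z)) (inv_mul_cancel₀ (three_ne_zero (α := ℂ)))
      simpa only [map_mul, map_ofNat, map_one] using h
    have h₁ : 3 * π (X 1) ^ 2 + π (C t) * π (X 0) ^ 4 = 0 := by
      have h : π (3 * X 1 ^ 2 + C t * X 0 ^ 4) = 0 :=
        Ideal.Quotient.eq_zero_iff_mem.mpr (Ideal.subset_span (by simp))
      simpa only [map_mul, map_add, map_pow, map_ofNat] using h
    have h₂ : 3 * π (X 0) ^ 5 + 2 * π (C t) * π (X 0) ^ 3 * π (X 1) = 0 := by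
      have h : π (3 * X 0 ^ 5 + 2 * C t * X 0 ^ 3 * X 1) = 0 :=
        Ideal.Quotient.eq_zero_iff_mem.mpr (Ideal.subset_span (by simp))
      simpa only [map_mul, map_add, map_pow, map_ofNat] using h
    rw [map_pow]
    exact pow_four_eq_zero_of_relations h₁ h₂ hu hk a b
end
end

section
/- For every symmetric tensor a : (Fin 2)³ → ℂ (a binary cubic) and every invertible upper triangular matrix M ∈ GL(2,ℂ), the ratio JK²/L³ is an absolute invariant under the action (X,Y) ↦ M(X,Y): that is, J(M·a)·K(M·a)²·L(a)³ = J(a)·K(a)²·L(M·a)³, where (M·a)_{ijk} = Σ_{p,q,r} a_{pqr} M^p_i M^q_j M^r_k. -/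
noncomputable section
open Finset

/-- The partial contraction `c_i^j = Σ a_{ipq} ε^{jk} ε^{pl} ε^{qm} a_{klm}` of
a binary cubic tensor. -/
def cC (a : Fin 2 → Fin 2 → Fin 2 → ℂ) (i j : Fin 2) : ℂ :=
  ∑ p : Fin 2, ∑ q : Fin 2, ∑ k : Fin 2, ∑ l : Fin 2, ∑ m : Fin 2,
    a i p q * eps2 j k * eps2 p l * eps2 q m * a k l m

/-- The degree-4 `SL(2,ℂ)`-invariant `J = Σ c_i^j c_j^i` of a binary cubic,
proportional to the discriminant. -/
def JC (a : Fin 2 → Fin 2 → Fin 2 → ℂ) : ℂ :=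
  ∑ i : Fin 2, ∑ j : Fin 2, cC a i j * cC a j i

/-- The covector `e = (1,0)`, preserved up to scale by upper triangular
matrices. -/
def eC : Fin 2 → ℂ := fun i => if i = 0 then 1 else 0

/-- The degree-1 invariant `K = Σ a_{ijk} e^i e^j e^k` (the coefficient of `X³`). -/
def KC (a : Fin 2 → Fin 2 → Fin 2 → ℂ) : ℂ :=
  ∑ i : Fin 2, ∑ j : Fin 2, ∑ k : Fin 2, a i j k * eC i * eC j * eC k

/-- The degree-2 invariant `L = Σ a_{ijk} a_{lmn} ε^{il} ε^{jm} e^k e^n`. -/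
def LC (a : Fin 2 → Fin 2 → Fin 2 → ℂ) : ℂ :=
  ∑ i : Fin 2, ∑ j : Fin 2, ∑ k : Fin 2, ∑ l : Fin 2, ∑ m : Fin 2, ∑ n : Fin 2,
    a i j k * a l m n * eps2 i l * eps2 j m * eC k * eC n

/-- A binary cubic tensor is symmetric if invariant under permutations of its
indices. -/
def SymC (a : Fin 2 → Fin 2 → Fin 2 → ℂ) : Prop :=
  ∀ i j k : Fin 2, a i j k = a j i k ∧ a i j k = a i k j

/-- The substitution action `(M·a)_{ijk} = Σ_{p,q,r} a_{pqr} M^p_i M^q_j M^r_k`. -/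
def actC (M : Matrix (Fin 2) (Fin 2) ℂ) (a : Fin 2 → Fin 2 → Fin 2 → ℂ) :
    Fin 2 → Fin 2 → Fin 2 → ℂ := fun i j k =>
  ∑ p : Fin 2, ∑ q : Fin 2, ∑ r : Fin 2, a p q r * M p i * M q j * M r k

theorem SymC.actC {a : Fin 2 → Fin 2 → Fin 2 → ℂ} (ha : SymC a)
    (M : Matrix (Fin 2) (Fin 2) ℂ) : SymC (actC M a) := by
  have h₁ : a 1 0 0 = a 0 1 0 := (ha 1 0 0).1
  have h₂ : a 0 1 0 = a 0 0 1 := (ha 0 1 0).2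
  have h₃ : a 1 0 1 = a 0 1 1 := (ha 1 0 1).1
  have h₄ : a 1 1 0 = a 1 0 1 := (ha 1 1 0).2
  intro i j k
  simp only [_root_.actC, Fin.sum_univ_two, h₁, h₂, h₃, h₄]
  constructor <;> ring

theorem KC_eq (a : Fin 2 → Fin 2 → Fin 2 → ℂ) : KC a = a 0 0 0 := by
  simp [KC, eC]

theorem SymC.LC_eq {a : Fin 2 → Fin 2 → Fin 2 → ℂ} (ha : SymC a) :
    LC a = 2 * (a 0 0 0 * a 0 1 1 - a 0 0 1 ^ 2) := by
  have h₁ : a 1 0 0 = a 0 1 0 := (ha 1 0 0).1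
  have h₂ : a 0 1 0 = a 0 0 1 := (ha 0 1 0).2
  have h₃ : a 1 0 1 = a 0 1 1 := (ha 1 0 1).1
  have h₄ : a 1 1 0 = a 1 0 1 := (ha 1 1 0).2
  simp [LC, eps2, eC, Fin.sum_univ_two, h₁, h₂, h₃, h₄]
  ring

theorem SymC.JC_eq {a : Fin 2 → Fin 2 → Fin 2 → ℂ} (ha : SymC a) :
    JC a = 2 * (a 0 0 0 * a 1 1 1 - a 0 0 1 * a 0 1 1) ^ 2
      - 8 * (a 0 0 0 * a 0 1 1 - a 0 0 1 ^ 2) * (a 0 0 1 * a 1 1 1 - a 0 1 1 ^ 2) := by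
  have h₁ : a 1 0 0 = a 0 1 0 := (ha 1 0 0).1
  have h₂ : a 0 1 0 = a 0 0 1 := (ha 0 1 0).2
  have h₃ : a 1 0 1 = a 0 1 1 := (ha 1 0 1).1
  have h₄ : a 1 1 0 = a 1 0 1 := (ha 1 1 0).2
  simp [JC, cC, eps2, Fin.sum_univ_two, h₁, h₂, h₃, h₄]
  ring

theorem KC_actC (a : Fin 2 → Fin 2 → Fin 2 → ℂ) {M : Matrix (Fin 2) (Fin 2) ℂ}
    (hupper : M 1 0 = 0) : KC (actC M a) = M 0 0 ^ 3 * KC a := by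
  simp only [KC_eq, actC, Fin.sum_univ_two, hupper]
  ring

theorem SymC.LC_actC {a : Fin 2 → Fin 2 → Fin 2 → ℂ} (ha : SymC a)
    {M : Matrix (Fin 2) (Fin 2) ℂ} (hupper : M 1 0 = 0) :
    LC (_root_.actC M a) = M.det ^ 2 * M 0 0 ^ 2 * LC a := by
  have h₁ : a 1 0 0 = a 0 1 0 := (ha 1 0 0).1
  have h₂ : a 0 1 0 = a 0 0 1 := (ha 0 1 0).2
  rw [(ha.actC M).LC_eq, ha.LC_eq, Matrix.det_fin_two]
  simp only [_root_.actC, Fin.sum_univ_two, h₁, h₂, hupper]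
  ring

theorem SymC.JC_actC {a : Fin 2 → Fin 2 → Fin 2 → ℂ} (ha : SymC a)
    (M : Matrix (Fin 2) (Fin 2) ℂ) : JC (_root_.actC M a) = M.det ^ 6 * JC a := by
  have h₁ : a 1 0 0 = a 0 1 0 := (ha 1 0 0).1
  have h₂ : a 0 1 0 = a 0 0 1 := (ha 0 1 0).2
  have h₃ : a 1 0 1 = a 0 1 1 := (ha 1 0 1).1
  have h₄ : a 1 1 0 = a 1 0 1 := (ha 1 1 0).2
  rw [(ha.actC M).JC_eq, ha.JC_eq, Matrix.det_fin_two]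
  simp only [_root_.actC, Fin.sum_univ_two, h₁, h₂, h₃, h₄]
  ring

/-- For every symmetric binary cubic tensor `a` and every invertible upper
triangular `M ∈ GL(2,ℂ)`, the ratio `JK²/L³` is an absolute invariant:
`J(M·a)·K(M·a)²·L(a)³ = J(a)·K(a)²·L(M·a)³`. -/
theorem statement18 (a : Fin 2 → Fin 2 → Fin 2 → ℂ) (ha : SymC a)
    (M : Matrix (Fin 2) (Fin 2) ℂ) (hM : IsUnit M.det) (hupper : M 1 0 = 0) :
    JC (actC M a) * KC (actC M a) ^ 2 * LC a ^ 3
      = JC a * KC a ^ 2 * LC (actC M a) ^ 3 := by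
  rw [ha.JC_actC, KC_actC a hupper, ha.LC_actC hupper]
  ring
end
end

section
/- Let t ∈ ℂ and let a(t) be the symmetric tensor of the binary sextic 27t⁴X⁶ − 1125tX⁵Y − 675t³X⁴Y² + 6250X³Y³ + 1125t²X²Y⁴ + 108t⁴XY⁵ − 125tY⁶ (the polynomial representing the multiplication ⨀⁶𝔪/𝔪² → 𝔪⁶ in the moduli algebra of the singularity x⁵ + tx³y² + y⁵ + z² = 0). Then, with J = J(a(t)) and K = K(a(t)), one has the identity 3·(108t⁵ + 3125)·J² = 78125·(J² − 2K) for all t ∈ ℂ; in particular for 108t⁵+3125 ≠ 0 and J² ≠ 2K, the absolute invariant J²/(J²−2K) equals 78125/(3(108t⁵+3125)). -/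
noncomputable section
open Finset

/-- The covariant `b^{ijklmn} = Σ a_{pqrstu} ε^{pi} ε^{qj} ε^{rk} ε^{sl} ε^{tm} ε^{un}`
of a binary sextic tensor. -/
def bS (a : Fin 2 → Fin 2 → Fin 2 → Fin 2 → Fin 2 → Fin 2 → ℂ)
    (i j k l m n : Fin 2) : ℂ :=
  ∑ p : Fin 2, ∑ q : Fin 2, ∑ r : Fin 2, ∑ s : Fin 2, ∑ t : Fin 2, ∑ u : Fin 2,
    a p q r s t u * eps2 p i * eps2 q j * eps2 r k * eps2 s l * eps2 t m * eps2 u n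

/-- The covariant `c_{ij}^{kl} = Σ a_{ijpqrs} b^{klpqrs}` of a binary sextic. -/
def cS (a : Fin 2 → Fin 2 → Fin 2 → Fin 2 → Fin 2 → Fin 2 → ℂ) (i j k l : Fin 2) : ℂ :=
  ∑ p : Fin 2, ∑ q : Fin 2, ∑ r : Fin 2, ∑ s : Fin 2, a i j p q r s * bS a k l p q r s

/-- The degree-2 invariant `J = Σ c_{ij}^{ij}` of a binary sextic. -/
def JS (a : Fin 2 → Fin 2 → Fin 2 → Fin 2 → Fin 2 → Fin 2 → ℂ) : ℂ :=
  ∑ i : Fin 2, ∑ j : Fin 2, cS a i j i j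

/-- The degree-4 invariant `K = Σ c_{ij}^{kl} c_{kl}^{ij}` of a binary sextic. -/
def KS (a : Fin 2 → Fin 2 → Fin 2 → Fin 2 → Fin 2 → Fin 2 → ℂ) : ℂ :=
  ∑ i : Fin 2, ∑ j : Fin 2, ∑ k : Fin 2, ∑ l : Fin 2, cS a i j k l * cS a k l i j

/-- The symmetric tensor of the binary sextic
`27t⁴X⁶ − 1125tX⁵Y − 675t³X⁴Y² + 6250X³Y³ + 1125t²X²Y⁴ + 108t⁴XY⁵ − 125tY⁶`,
the polynomial representing the multiplication `⨀⁶𝔪/𝔪² → 𝔪⁶` in the moduli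
algebra of the singularity `x⁵ + tx³y² + y⁵ + z² = 0` (obtained by symmetrizing
the coefficients; `X` corresponds to index `0`, `Y` to index `1`). -/
def aS (t : ℂ) : Fin 2 → Fin 2 → Fin 2 → Fin 2 → Fin 2 → Fin 2 → ℂ :=
  fun i j k l m n =>
    if i.val + j.val + k.val + l.val + m.val + n.val = 0 then 27 * t ^ 4
    else if i.val + j.val + k.val + l.val + m.val + n.val = 1 then -1125 * t / 6
    else if i.val + j.val + k.val + l.val + m.val + n.val = 2 then -675 * t ^ 3 / 15
    else if i.val + j.val + k.val + l.val + m.val + n.val = 3 then 6250 / 20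
    else if i.val + j.val + k.val + l.val + m.val + n.val = 4 then 1125 * t ^ 2 / 15
    else if i.val + j.val + k.val + l.val + m.val + n.val = 5 then 108 * t ^ 4 / 6
    else -125 * t

/-- Pairing with the antisymmetric symbol flips the index, up to a sign. -/
theorem eps2_eq_ite (p i : Fin 2) :
    eps2 p i = if p = 1 - i then -(-1) ^ i.val else 0 := by
  fin_cases p <;> fin_cases i <;> simp [eps2]

theorem bS_eq (a : Fin 2 → Fin 2 → Fin 2 → Fin 2 → Fin 2 → Fin 2 → ℂ) (i j k l m n : Fin 2) :
    bS a i j k l m n = (-1) ^ (i.val + j.val + k.val + l.val + m.val + n.val) *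
      a (1 - i) (1 - j) (1 - k) (1 - l) (1 - m) (1 - n) := by
  simp only [bS, eps2_eq_ite, mul_ite, ite_mul, mul_zero, zero_mul, Finset.sum_ite_eq',
    Finset.mem_univ, if_true]
  ring

/-- The covariant `c` of a symmetric tensor with entries `A`. -/
theorem cS_eq_of_symm {a : Fin 2 → Fin 2 → Fin 2 → Fin 2 → Fin 2 → Fin 2 → ℂ} {A : ℕ → ℂ}
    (ha : ∀ i j k l m n, a i j k l m n =
      A (i.val + j.val + k.val + l.val + m.val + n.val)) (i j k l : Fin 2) :
    cS a i j k l = (-1) ^ (k.val + l.val) *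
      (A (i.val + j.val) * A (6 - (k.val + l.val))
        - 4 * (A (i.val + j.val + 1) * A (5 - (k.val + l.val)))
        + 6 * (A (i.val + j.val + 2) * A (4 - (k.val + l.val)))
        - 4 * (A (i.val + j.val + 3) * A (3 - (k.val + l.val)))
        + A (i.val + j.val + 4) * A (2 - (k.val + l.val))) := by
  simp only [cS, bS_eq, ha, Fin.sum_univ_two]
  generalize i.val + j.val = s
  fin_cases k <;> fin_cases l <;> simp <;> ring_nf

/-- The entries of the symmetric tensor `aS t`. -/
def aSEntry (t : ℂ) : ℕ → ℂ
  | 0 => 27 * t ^ 4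
  | 1 => -1125 * t / 6
  | 2 => -675 * t ^ 3 / 15
  | 3 => 6250 / 20
  | 4 => 1125 * t ^ 2 / 15
  | 5 => 108 * t ^ 4 / 6
  | _ => -125 * t

theorem aS_eq_aSEntry (t : ℂ) (i j k l m n : Fin 2) :
    aS t i j k l m n = aSEntry t (i.val + j.val + k.val + l.val + m.val + n.val) := by
  unfold aS
  generalize i.val + j.val + k.val + l.val + m.val + n.val = s
  rcases s with _ | _ | _ | _ | _ | _ | s <;> simp [aSEntry]

theorem JS_aS (t : ℂ) : JS (aS t) = -625 * (108 * t ^ 5 + 3125) := by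
  simp [JS, cS_eq_of_symm (aS_eq_aSEntry t), Fin.sum_univ_two, aSEntry]
  ring

theorem KS_aS (t : ℂ) : 2 * 78125 * KS (aS t) =
    (78125 - 3 * (108 * t ^ 5 + 3125)) * (-625 * (108 * t ^ 5 + 3125)) ^ 2 := by
  simp [KS, cS_eq_of_symm (aS_eq_aSEntry t), Fin.sum_univ_two, aSEntry]
  ring

/-- For the binary sextic
`27t⁴X⁶ − 1125tX⁵Y − 675t³X⁴Y² + 6250X³Y³ + 1125t²X²Y⁴ + 108t⁴XY⁵ − 125tY⁶`
one has `3(108t⁵ + 3125)J² = 78125(J² − 2K)`; in particular for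
`108t⁵+3125 ≠ 0` and `J² ≠ 2K`, the absolute invariant `J²/(J²−2K)` equals
`78125/(3(108t⁵+3125))`. -/
theorem statement19 (t : ℂ) :
    3 * (108 * t ^ 5 + 3125) * JS (aS t) ^ 2
        = 78125 * (JS (aS t) ^ 2 - 2 * KS (aS t))
      ∧ (108 * t ^ 5 + 3125 ≠ 0 → JS (aS t) ^ 2 ≠ 2 * KS (aS t) →
          JS (aS t) ^ 2 / (JS (aS t) ^ 2 - 2 * KS (aS t))
            = 78125 / (3 * (108 * t ^ 5 + 3125))) := by
  have h : 3 * (108 * t ^ 5 + 3125) * JS (aS t) ^ 2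
      = 78125 * (JS (aS t) ^ 2 - 2 * KS (aS t)) := by
    rw [JS_aS]
    linear_combination KS_aS t
  refine ⟨h, fun ht hJK => ?_⟩
  rw [div_eq_div_iff (sub_ne_zero.mpr hJK) (mul_ne_zero three_ne_zero ht)]
  linear_combination h
end
end
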